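/- Smoothness of the Alexander deformation in both variables: let φ : B_r → ℂⁿ be C^∞ on B_r with φ(0) = 0, and let L = Dφ(0) be its Fréchet derivative at 0 (taken within B_r). Define F : ℝ × ℂⁿ → ℂⁿ by F(t, z) = t⁻¹·φ(t·z) for t ≠ 0 and F(0, z) = L(z). Then F is C^∞ on the set [0, 1] × B_r (in the sense of ContDiffOn). -/

import Mathlib

open scoped BigOperators

/-- An interval integral of a `C^n` function depends in a `C^n` way on its parameter. -/
theorem ContDiff.intervalIntegral_param_nat.{u} {E : Type u} [NormedAddCommGroup E] [NormedSpace ℝ E]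
    [ProperSpace E] {a b : ℝ} (n : ℕ) :
    ∀ {F : Type u} [NormedAddCommGroup F] [NormedSpace ℝ F] {f : E × ℝ → F},
      ContDiff ℝ n f → ContDiff ℝ n fun x => ∫ s in a..b, f (x, s) := by
  induction n with
  | zero =>
    intro F _ _ f hf
    simp only [Nat.cast_zero, contDiff_zero] at hf ⊢
    exact intervalIntegral.continuous_parametric_intervalIntegral_of_continuous'
      (f := fun x s => f (x, s)) hf a b
  | succ n ih =>
    intro F _ _ f hf
    have hf' : ContDiff ℝ n fun p : E × ℝ =>
        (fderiv ℝ f p).comp (ContinuousLinearMap.inl ℝ E ℝ) :=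
      (hf.fderiv_right (by norm_cast)).clm_comp contDiff_const
    refine contDiff_succ_iff_hasFDerivAt.2 ⟨_, ih hf', fun x₀ => ?_⟩
    obtain ⟨C, hC⟩ := ((isCompact_closedBall x₀ 1).prod
      (isCompact_uIcc (a := a) (b := b))).exists_bound_of_continuousOn hf'.continuous.continuousOn
    refine intervalIntegral.hasFDerivAt_integral_of_dominated_of_fderiv_le
      (F := fun x s => f (x, s))
      (F' := fun x s => (fderiv ℝ f (x, s)).comp (ContinuousLinearMap.inl ℝ E ℝ))
      (bound := fun _ => C) (Metric.closedBall_mem_nhds x₀ one_pos)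
      (.of_forall fun x => ?_) ?_ ?_ (.of_forall fun s hs x hx => ?_)
      intervalIntegrable_const (.of_forall fun s _ x _ => ?_)
    · exact (hf.continuous.comp (by fun_prop : Continuous fun s : ℝ => (x, s))).aestronglyMeasurable
    · exact (hf.continuous.comp
        (by fun_prop : Continuous fun s : ℝ => (x₀, s))).intervalIntegrable _ _
    · exact (hf'.continuous.comp
        (by fun_prop : Continuous fun s : ℝ => (x₀, s))).aestronglyMeasurable
    · exact hC (x, s) ⟨hx, Set.uIoc_subset_uIcc hs⟩
    · exact ((hf.differentiable (by simp)) (x, s)).hasFDerivAt.comp x (hasFDerivAt_prodMk_left x s)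

/-- **Hadamard's lemma** along rays: a smooth `ψ` with `ψ 0 = 0` satisfies `ψ (t • z) = t • G (t, z)`
with `G` smooth and `G (0, z) = Dψ(0) z`. -/
theorem ContDiff.exists_contDiff_smul_eq.{u} {E F : Type u} [NormedAddCommGroup E] [NormedSpace ℝ E]
    [ProperSpace E] [NormedAddCommGroup F] [NormedSpace ℝ F] [CompleteSpace F] {ψ : E → F}
    (hψ : ContDiff ℝ (⊤ : ℕ∞) ψ) (h0 : ψ 0 = 0) :
    ∃ G : ℝ × E → F, ContDiff ℝ (⊤ : ℕ∞) G ∧ (∀ z, G (0, z) = fderiv ℝ ψ 0 z) ∧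
      ∀ t z, t • G (t, z) = ψ (t • z) := by
  have hψ' : ContDiff ℝ (⊤ : ℕ∞) (fderiv ℝ ψ) := hψ.fderiv_right (by norm_cast)
  have hf : ContDiff ℝ (⊤ : ℕ∞) fun p : (ℝ × E) × ℝ =>
      fderiv ℝ ψ (p.2 • p.1.1 • p.1.2) p.1.2 :=
    (hψ'.comp (by fun_prop)).clm_apply (by fun_prop)
  refine ⟨fun p => ∫ s in (0 : ℝ)..1, fderiv ℝ ψ (s • p.1 • p.2) p.2,
    contDiff_infty.2 fun n => ContDiff.intervalIntegral_param_nat n (contDiff_infty.1 hf n),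
    fun z => by simp, fun t z => ?_⟩
  have hd : ∀ s : ℝ, HasDerivAt (fun s : ℝ => ψ (s • t • z))
      (t • fderiv ℝ ψ (s • t • z) z) s := fun s => by
    have h1 : HasDerivAt (fun s : ℝ => s • t • z) (t • z) s := by
      simpa using (hasDerivAt_id s).smul_const (t • z)
    simpa [Function.comp_def] using ((hψ.differentiable (by simp)) (s • t • z)).hasFDerivAt.comp_hasDerivAt s h1
  have hc : Continuous fun s : ℝ => t • fderiv ℝ ψ (s • t • z) z :=
    (hf.continuous.comp (by fun_prop : Continuous fun s : ℝ => ((t, z), s))).const_smul t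
  have := intervalIntegral.integral_eq_sub_of_hasDerivAt (fun s _ => hd s)
    (hc.intervalIntegrable 0 1)
  simpa [h0, intervalIntegral.integral_smul] using this

/-- A function smooth on a ball agrees on the concentric ball of half the radius with a globally
smooth function. -/
theorem ContDiffOn.exists_contDiff_eqOn_closedBall {E F : Type*} [NormedAddCommGroup E]
    [NormedSpace ℝ E] [HasContDiffBump E] [NormedAddCommGroup F] [NormedSpace ℝ F]
    {φ : E → F} {c : E} {r : ℝ} (hr : 0 < r)
    (hφ : ContDiffOn ℝ (⊤ : ℕ∞) φ (Metric.closedBall c r)) :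
    ∃ ψ : E → F, ContDiff ℝ (⊤ : ℕ∞) ψ ∧ Set.EqOn ψ φ (Metric.closedBall c (r / 2)) := by
  let b : ContDiffBump c := ⟨r / 2, 3 * r / 4, by linarith, by linarith⟩
  refine ⟨fun x => b x • φ x, contDiff_iff_contDiffAt.2 fun x => ?_, fun x hx => ?_⟩
  · rcases lt_or_ge (Dist.dist x c) r with hx | hx
    · exact b.contDiffAt.smul (hφ.contDiffAt (Metric.closedBall_mem_nhds_of_mem hx))
    · refine contDiffAt_const (c := (0 : F)) |>.congr_of_eventuallyEq ?_
      filter_upwards [Metric.isClosed_closedBall.isOpen_compl.mem_nhds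
        (show x ∈ (Metric.closedBall c (3 * r / 4))ᶜ by
          simp only [Set.mem_compl_iff, Metric.mem_closedBall, not_le]; linarith)] with y hy
      simp only [Set.mem_compl_iff, Metric.mem_closedBall, not_le] at hy
      rw [b.zero_of_le_dist hy.le, zero_smul]
  · simp only [b.one_of_mem_closedBall hx, one_smul]

/-- Smoothness of the Alexander deformation in both variables: if `φ : B_r → ℂⁿ` is
`C^∞` on `B_r` with `φ(0) = 0` and `L = Dφ(0)` (derivative within `B_r`), then
`F(t, z) = t⁻¹·φ(t·z)` for `t ≠ 0`, `F(0, z) = L(z)`, is `C^∞` on `[0, 1] × B_r`. -/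
theorem alexander_deformation_smooth (n : ℕ) (hn : 1 ≤ n) (r : ℝ) (hr : 0 < r)
    (φ : EuclideanSpace ℂ (Fin n) → EuclideanSpace ℂ (Fin n))
    (hφ : ContDiffOn ℝ (⊤ : ℕ∞) φ (Metric.closedBall 0 r)) (h0 : φ 0 = 0)
    (L : EuclideanSpace ℂ (Fin n) →L[ℝ] EuclideanSpace ℂ (Fin n))
    (hL : L = fderivWithin ℝ φ (Metric.closedBall 0 r) 0)
    (F : ℝ × EuclideanSpace ℂ (Fin n) → EuclideanSpace ℂ (Fin n))
    (hF : ∀ t : ℝ, ∀ z : EuclideanSpace ℂ (Fin n),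
      F (t, z) = if t = 0 then L z else t⁻¹ • φ (t • z)) :
    ContDiffOn ℝ (⊤ : ℕ∞) F (Set.Icc (0 : ℝ) 1 ×ˢ Metric.closedBall 0 r) := by
  obtain ⟨ψ, hψ, hψφ⟩ := hφ.exists_contDiff_eqOn_closedBall hr
  have hr2 : 0 < r / 2 := half_pos hr
  obtain ⟨G, hG, hG0, hGt⟩ := hψ.exists_contDiff_smul_eq
    ((hψφ (Metric.mem_closedBall_self hr2.le)).trans h0)
  have hLψ : L = fderiv ℝ ψ 0 := by
    rw [hL, fderivWithin_of_mem_nhds (Metric.closedBall_mem_nhds 0 hr)]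
    exact (hψφ.eventuallyEq_of_mem (Metric.closedBall_mem_nhds 0 hr2)).symm.fderiv_eq
  rintro ⟨t₀, z₀⟩ ⟨ht₀, hz₀⟩
  by_cases h : t₀ = 0
  · subst h
    refine hG.contDiffWithinAt.congr_of_eventuallyEq_of_mem ?_ ⟨ht₀, hz₀⟩
    have hnear : ∀ᶠ p : ℝ × EuclideanSpace ℂ (Fin n) in nhds (0, z₀), p.1 < 1 / 2 :=
      continuous_fst.continuousAt.eventually_lt continuousAt_const (by norm_num)
    filter_upwards [self_mem_nhdsWithin, nhdsWithin_le_nhds hnear] with p hp hlt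
    obtain ⟨t, z⟩ := p
    obtain ⟨⟨ht0, -⟩, hz⟩ := hp
    rw [hF]
    split_ifs with h
    · rw [h, hG0, hLψ]
    · rw [inv_smul_eq_iff₀ h, hGt]
      refine (hψφ ?_).symm
      rw [mem_closedBall_zero_iff] at hz ⊢
      rw [norm_smul, Real.norm_of_nonneg ht0]
      simp only at hlt ht0
      nlinarith [norm_nonneg z]
  · have hmaps : Set.MapsTo (fun p : ℝ × EuclideanSpace ℂ (Fin n) => p.1 • p.2)
        (Set.Icc (0 : ℝ) 1 ×ˢ Metric.closedBall 0 r) (Metric.closedBall 0 r) := by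
      rintro ⟨t, z⟩ ⟨⟨ht0, ht1⟩, hz⟩
      rw [mem_closedBall_zero_iff] at hz ⊢
      simp only at ht0 ht1 hz
      rw [norm_smul, Real.norm_of_nonneg ht0]
      nlinarith [norm_nonneg z]
    have hsm : ContDiffWithinAt ℝ (⊤ : ℕ∞)
        (fun p : ℝ × EuclideanSpace ℂ (Fin n) => p.1⁻¹ • φ (p.1 • p.2))
        (Set.Icc (0 : ℝ) 1 ×ˢ Metric.closedBall 0 r) (t₀, z₀) :=
      (contDiffWithinAt_fst.inv h).smul
        ((hφ.comp (contDiff_fst.smul contDiff_snd).contDiffOn hmaps) _ ⟨ht₀, hz₀⟩)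
    refine hsm.congr_of_eventuallyEq_of_mem ?_ ⟨ht₀, hz₀⟩
    filter_upwards [nhdsWithin_le_nhds (continuous_fst.continuousAt.eventually_ne h)] with p hp
    rw [← Prod.mk.eta (p := p), hF, if_neg hp]
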